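/- arXiv:2110.10307 — 3 statements merged into one kernel-verified Lean document; each statement's English description precedes it below -/
import Mathlib

section
/- Min-entropy smoothing for i.i.d. sources (Lemma 2): let 𝒴_1,…,𝒴_D and 𝒵 be finite alphabets, 𝒟 = {1,…,D}, and let q_{Y_𝒟 Z} be a pmf on (∏_{d∈𝒟}𝒴_d) × 𝒵; let q_{Y_𝒟^n Z^n} = q_{Y_𝒟 Z}^{⊗n} be the n-fold i.i.d. product. For every ε > 0 there exists a sub-normalized nonnegative function w_{Y_𝒟^n Z^n} on (∏_{d∈𝒟}𝒴_d^n) × 𝒵^n such that V(q_{Y_𝒟^n Z^n}, w_{Y_𝒟^n Z^n}) ≤ ε and, for every nonempty S ⊆ 𝒟, H∞( w_{Y_S^n Z^n} | q_{Z^n} ) ≥ n·H(Y_S | Z) − n·δ_S(n), where w_{Y_S^n Z^n} denotes the marginal of w_{Y_𝒟^n Z^n} on (∏_{d∈S}𝒴_d^n) × 𝒵^n, H(Y_S | Z) is the base-2 conditional Shannon entropy under q_{Y_𝒟 Z} with Y_S = (Y_d)_{d∈S}, 𝒴_S = ∏_{d∈S}𝒴_d, and δ_S(n) ≜ log₂(|𝒴_S|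 + 3) · sqrt( (2/n)·(D + log₂(1/ε)) ). -/
open scoped BigOperators
open Finset Filter

noncomputable section

namespace SecretSharing

open scoped Classical

/-! ### Basic Shannon information quantities (base 2) on finite probability spaces -/

variable {Ω : Type*} [Fintype Ω]

/-- `p` is a probability mass function on the finite type `Ω`. -/
def IsPMF (p : Ω → ℝ) : Prop := (∀ ω, 0 ≤ p ω) ∧ ∑ ω : Ω, p ω = 1

/-- Probability that the random variable `X` takes the value `a` under `p`. -/
def prob (p : Ω → ℝ) {A : Type*} (X : Ω → A) (a : A) : ℝ :=
  ∑ ω : Ω, if X ω = a then p ω else 0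

/-- Shannon entropy (in bits) of the random variable `X` under `p`. -/
def ent (p : Ω → ℝ) {A : Type*} [Fintype A] (X : Ω → A) : ℝ :=
  -∑ a : A, prob p X a * Real.logb 2 (prob p X a)

/-- Conditional Shannon entropy `H(X | Y)` in bits. -/
def condEnt (p : Ω → ℝ) {A B : Type*} [Fintype A] [Fintype B]
    (X : Ω → A) (Y : Ω → B) : ℝ :=
  ent p (fun ω => (X ω, Y ω)) - ent p Y

/-- Mutual information `I(X ; Y)` in bits. -/
def mutInf (p : Ω → ℝ) {A B : Type*} [Fintype A] [Fintype B]
    (X : Ω → A) (Y : Ω → B) : ℝ :=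
  ent p X + ent p Y - ent p (fun ω => (X ω, Y ω))

/-- Conditional mutual information `I(X ; Y | Z)` in bits. -/
def condMutInf (p : Ω → ℝ) {A B C : Type*} [Fintype A] [Fintype B] [Fintype C]
    (X : Ω → A) (Y : Ω → B) (Z : Ω → C) : ℝ :=
  condEnt p X Z - condEnt p X (fun ω => (Y ω, Z ω))


/-- Conditional min-entropy `H∞(w | q) = −log₂ max_{a, z ∈ supp(q)} w(a,z)/q(z)`
of a (sub-normalized nonnegative) joint function `w` given a pmf `q`. -/
def condMinEnt {A Z : Type*} (w : A → Z → ℝ) (q : Z → ℝ) : ℝ :=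
  - Real.logb 2 (sSup {y : ℝ | ∃ a z, q z ≠ 0 ∧ y = w a z / q z})

/-- Min-entropy `H∞(w) = −log₂ max w`. -/
def minEnt {A : Type*} (w : A → ℝ) : ℝ :=
  - Real.logb 2 (sSup (Set.range w))

/-- A family `F` of hash functions (given by the evaluation map `ev`) from `A`
to `{0,1}^r` is two-universal: for `x ≠ x'`, a uniformly chosen member collides
on `x, x'` with probability at most `2^{-r}`. -/
def TwoUniversal {A : Type*} (F : Type*) [Fintype F] {r : ℕ}
    (ev : F → A → (Fin r → Bool)) : Prop :=
  ∀ x x' : A, x ≠ x' →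
    ((Finset.univ.filter (fun f : F => ev f x = ev f x')).card : ℝ)
        / (Fintype.card F : ℝ)
      ≤ ((2 : ℝ) ^ r)⁻¹

lemma exp_neg_quad {x : ℝ} (hx : 0 ≤ x) : Real.exp (-x) ≤ 1 - x + x ^ 2 / 2 := by
  have h := Real.quadratic_le_exp_of_nonneg hx
  have hp : 0 < 1 - x + x ^ 2 / 2 := by nlinarith [sq_nonneg (x - 1)]
  rw [Real.exp_neg]
  rw [inv_le_comm₀ (Real.exp_pos _) hp]
  refine le_trans ?_ h
  rw [inv_le_iff_one_le_mul₀ hp]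
  nlinarith [sq_nonneg (x ^ 2)]

lemma sum_pi_prod {A : Type*} [Fintype A] {n : ℕ} (f : Fin n → A → ℝ) :
    ∑ a : Fin n → A, ∏ i, f i (a i) = ∏ i, ∑ x, f i x := by
  rw [Finset.prod_univ_sum]
  simp [Fintype.piFinset_univ]

/-- One-sided Chernoff bound for nonnegative variables. -/
lemma chernoff {A : Type*} [Fintype A] (P : A → ℝ) (hP : IsPMF P) (X : A → ℝ)
    (hX : ∀ a, 0 < P a → 0 ≤ X a) (M : ℝ) (hM : 0 < M) (hXM : ∑ a, P a * X a ^ 2 ≤ M)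
    (δ : ℝ) (hδ : 0 ≤ δ) (n : ℕ) :
    ∑ a : Fin n → A, (if ∑ i, X (a i) < n * (∑ a, P a * X a) - n * δ
      then ∏ i, P (a i) else 0) ≤ Real.exp (-(n * δ ^ 2 / (2 * M))) := by
  set μ := ∑ a, P a * X a with hμ
  set t := δ / M with ht
  have ht0 : 0 ≤ t := by positivity
  have h1 : ∑ a, P a * Real.exp (-(t * X a)) ≤ Real.exp (-(t * μ) + t ^ 2 * M / 2) := by
    calc ∑ a, P a * Real.exp (-(t * X a))
        ≤ ∑ a, P a * (1 - t * X a + (t * X a) ^ 2 / 2) := by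
          refine Finset.sum_le_sum fun a _ => ?_
          rcases (hP.1 a).eq_or_lt with h | h
          · simp [← h]
          · exact mul_le_mul_of_nonneg_left (exp_neg_quad (mul_nonneg ht0 (hX a h))) h.le
      _ = ∑ a, P a - t * μ + t ^ 2 / 2 * ∑ a, P a * X a ^ 2 := by
          rw [hμ, Finset.mul_sum, Finset.mul_sum, ← Finset.sum_sub_distrib,
            ← Finset.sum_add_distrib]
          exact Finset.sum_congr rfl fun a _ => by ring
      _ ≤ 1 - t * μ + t ^ 2 / 2 * M := by
          rw [hP.2]
          have : t ^ 2 / 2 * ∑ a, P a * X a ^ 2 ≤ t ^ 2 / 2 * M :=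
            mul_le_mul_of_nonneg_left hXM (by positivity)
          linarith
      _ ≤ _ := by
          have := Real.add_one_le_exp (-(t * μ) + t ^ 2 * M / 2)
          linarith
  calc _ ≤ ∑ a : Fin n → A, Real.exp (t * (n * μ - n * δ)) *
            ∏ i, (P (a i) * Real.exp (-(t * X (a i)))) := by
          refine Finset.sum_le_sum fun a _ => ?_
          have hp : 0 ≤ ∏ i, P (a i) := Finset.prod_nonneg fun i _ => hP.1 _
          rw [Finset.prod_mul_distrib, ← Real.exp_sum, mul_left_comm, ← Real.exp_add]
          split_ifs with h
          · refine le_mul_of_one_le_right hp ?_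
            rw [Real.one_le_exp_iff, Finset.sum_neg_distrib, ← Finset.mul_sum, ← sub_eq_add_neg,
              ← mul_sub]
            exact mul_nonneg ht0 (by linarith)
          · positivity
    _ = Real.exp (t * (n * μ - n * δ)) * (∑ a, P a * Real.exp (-(t * X a))) ^ n := by
          rw [← Finset.mul_sum, sum_pi_prod (fun _ a => P a * Real.exp (-(t * X a)))]
          simp
    _ ≤ Real.exp (t * (n * μ - n * δ)) * (Real.exp (-(t * μ) + t ^ 2 * M / 2)) ^ n := by
          refine mul_le_mul_of_nonneg_left (pow_le_pow_left₀ ?_ h1 n) (Real.exp_pos _).le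
          exact Finset.sum_nonneg fun a _ => mul_nonneg (hP.1 a) (Real.exp_pos _).le
    _ = _ := by
          rw [← Real.exp_nat_mul, ← Real.exp_add]
          congr 1
          rw [ht]
          field_simp
          ring

lemma concave_log_sq : ConcaveOn ℝ (Set.Ici (Real.exp 1)) (fun x => Real.log x ^ 2) := by
  have hpos : ∀ x ∈ Set.Ici (Real.exp 1), x ≠ 0 := fun x hx =>
    ((Real.exp_pos 1).trans_le hx).ne'
  have hd : ∀ x ∈ Set.Ici (Real.exp 1), HasDerivAt (fun x => Real.log x ^ 2)
      (2 * (Real.log x / x)) x := fun x hx => by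
    have := (Real.hasDerivAt_log (hpos x hx)).pow 2
    convert! this using 1
    simp [div_eq_mul_inv]; ring
  refine AntitoneOn.concaveOn_of_deriv (convex_Ici _)
    (fun x hx => (hd x hx).continuousAt.continuousWithinAt)
    (fun x hx => (hd x (interior_subset hx)).differentiableAt.differentiableWithinAt) ?_
  intro x hx y hy hxy
  rw [(hd x (interior_subset hx)).deriv, (hd y (interior_subset hy)).deriv]
  have := Real.log_div_self_antitoneOn (interior_subset hx) (interior_subset hy) hxy
  simp only at this
  linarith

lemma second_moment {A : Type*} [Fintype A] (P : A → ℝ) (hP : IsPMF P) (r : A → ℝ)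
    (hr0 : ∀ a, 0 ≤ r a) (hr : ∀ a, 0 < P a → 1 ≤ r a) (k : ℝ) (hk : ∑ a, P a * r a ≤ k) :
    ∑ a, P a * Real.logb 2 (r a) ^ 2 ≤ Real.logb 2 (k + 3) ^ 2 := by
  have hl2 : 0 < Real.log 2 := Real.log_pos (by norm_num)
  have he : Real.exp 1 ≤ 3 := Real.exp_one_lt_three.le
  have hs0 : 0 ≤ ∑ a, P a * r a := Finset.sum_nonneg fun a _ => mul_nonneg (hP.1 a) (hr0 a)
  have key : ∑ a, P a * Real.log (r a) ^ 2 ≤ Real.log (k + 3) ^ 2 := by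
    have J := concave_log_sq.le_map_sum (t := Finset.univ) (w := P) (p := fun a => r a + 3)
      (fun a _ => hP.1 a) hP.2 (fun a _ => by
        have := hr0 a
        simp only [Set.mem_Ici]; linarith)
    simp only [smul_eq_mul] at J
    calc _ ≤ ∑ a, P a * Real.log (r a + 3) ^ 2 := by
            refine Finset.sum_le_sum fun a _ => ?_
            rcases (hP.1 a).eq_or_lt with h | h
            · simp [← h]
            · have h1 := hr a h
              refine mul_le_mul_of_nonneg_left (pow_le_pow_left₀ (Real.log_nonneg h1) ?_ 2) h.le
              exact Real.log_le_log (by linarith) (by linarith)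
      _ ≤ _ := J
      _ ≤ _ := by
            have e : ∑ a, P a * (r a + 3) = ∑ a, P a * r a + 3 := by
              simp [mul_add, Finset.sum_add_distrib, ← Finset.sum_mul, hP.2]
            rw [e]
            refine pow_le_pow_left₀ (Real.log_nonneg (by linarith)) ?_ 2
            exact Real.log_le_log (by linarith) (by linarith)
  have e : ∑ a, P a * Real.logb 2 (r a) ^ 2 = (∑ a, P a * Real.log (r a) ^ 2) / Real.log 2 ^ 2 := by
    rw [Finset.sum_div]
    refine Finset.sum_congr rfl fun a _ => ?_
    rw [Real.logb]; ring
  rw [e, Real.logb, div_pow]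
  gcongr

lemma prob_nonneg {p : Ω → ℝ} (hp : IsPMF p) {A : Type*} (X : Ω → A) (a : A) : 0 ≤ prob p X a :=
  Finset.sum_nonneg fun ω _ => by split_ifs <;> simp [hp.1]

lemma le_prob {p : Ω → ℝ} (hp : IsPMF p) {A : Type*} (X : Ω → A) (ω : Ω) : p ω ≤ prob p X (X ω) := by
  have := Finset.single_le_sum (f := fun ω' => if X ω' = X ω then p ω' else 0)
    (fun ω' _ => by split_ifs <;> simp [hp.1]) (Finset.mem_univ ω)
  simpa [prob] using this

lemma sum_prob_mul (p : Ω → ℝ) {A : Type*} [Fintype A] (X : Ω → A) (g : A → ℝ) :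
    ∑ a, prob p X a * g a = ∑ ω, p ω * g (X ω) := by
  simp only [prob, Finset.sum_mul]
  rw [Finset.sum_comm]
  refine Finset.sum_congr rfl fun ω _ => ?_
  simp [ite_mul]

lemma prob_pair_le {p : Ω → ℝ} (hp : IsPMF p) {A B : Type*} (X : Ω → A) (Y : Ω → B) (a : A) (b : B) :
    prob p (fun ω => (X ω, Y ω)) (a, b) ≤ prob p Y b := by
  refine Finset.sum_le_sum fun ω _ => ?_
  have := hp.1 ω
  by_cases h : Y ω = b
  · simp only [h, if_true]; split_ifs <;> simp [this]
  · simp [h]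

/-- the ratio `q(y)/q(x,y)` -/
def ratio (p : Ω → ℝ) {A B : Type*} (X : Ω → A) (Y : Ω → B) (ω : Ω) : ℝ :=
  prob p Y (Y ω) / prob p (fun ω => (X ω, Y ω)) (X ω, Y ω)

lemma ratio_nonneg {p : Ω → ℝ} (hp : IsPMF p) {A B : Type*} (X : Ω → A) (Y : Ω → B) (ω : Ω) :
    0 ≤ ratio p X Y ω := div_nonneg (prob_nonneg hp _ _) (prob_nonneg hp _ _)

lemma one_le_ratio {p : Ω → ℝ} (hp : IsPMF p) {A B : Type*} (X : Ω → A) (Y : Ω → B) (ω : Ω)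
    (h : 0 < p ω) : 1 ≤ ratio p X Y ω := by
  have h1 := h.trans_le (le_prob hp (fun ω => (X ω, Y ω)) ω)
  exact (one_le_div h1).2 (prob_pair_le hp X Y _ _)

lemma sum_ratio {p : Ω → ℝ} (hp : IsPMF p) {A B : Type*} [Fintype A] [Fintype B]
    (X : Ω → A) (Y : Ω → B) : ∑ ω, p ω * ratio p X Y ω ≤ Fintype.card A := by
  have h := sum_prob_mul p (fun ω => (X ω, Y ω))
    (fun c => prob p Y c.2 / prob p (fun ω => (X ω, Y ω)) c)
  calc _ = _ := h.symm
    _ ≤ ∑ c : A × B, prob p Y c.2 := by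
        refine Finset.sum_le_sum fun c _ => ?_
        rcases (prob_nonneg hp (fun ω => (X ω, Y ω)) c).eq_or_lt with h | h
        · rw [← h]; simpa using prob_nonneg hp Y c.2
        · rw [mul_div_cancel₀ _ h.ne']
    _ = _ := by
        rw [Fintype.sum_prod_type]
        have := sum_prob_mul p Y (fun _ => 1)
        simp only [mul_one, hp.2] at this
        simp [this]

lemma sum_log_ratio {p : Ω → ℝ} (hp : IsPMF p) {A B : Type*} [Fintype A] [Fintype B]
    (X : Ω → A) (Y : Ω → B) : ∑ ω, p ω * Real.logb 2 (ratio p X Y ω) = condEnt p X Y := by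
  rw [condEnt, ent, ent, sum_prob_mul p Y (fun b => Real.logb 2 (prob p Y b)),
    sum_prob_mul p (fun ω => (X ω, Y ω)) (fun b => Real.logb 2 (prob p (fun ω => (X ω, Y ω)) b)),
    sub_neg_eq_add, neg_add_eq_sub, ← Finset.sum_sub_distrib]
  refine Finset.sum_congr rfl fun ω _ => ?_
  rcases (hp.1 ω).eq_or_lt with h | h
  · simp [← h]
  · rw [ratio, Real.logb_div (h.trans_le (le_prob hp Y ω)).ne'
      (h.trans_le (le_prob hp (fun ω => (X ω, Y ω)) ω)).ne']
    ring

/-- The AEP tail bound. -/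
lemma aep {p : Ω → ℝ} (hp : IsPMF p) {A B : Type*} [Fintype A] [Fintype B]
    (X : Ω → A) (Y : Ω → B) (n : ℕ) (x : ℝ) (hx : 0 ≤ x) :
    ∑ a : Fin n → Ω, (if ∑ i, Real.logb 2 (ratio p X Y (a i)) < n * condEnt p X Y -
        n * (Real.logb 2 ((Fintype.card A : ℝ) + 3) * Real.sqrt ((2 / (n : ℝ)) * x))
      then ∏ i, p (a i) else 0) ≤ (2 : ℝ) ^ (-x) := by
  rcases Nat.eq_zero_or_pos n with rfl | hn
  · simp; positivity
  have hL : 0 < Real.logb 2 ((Fintype.card A : ℝ) + 3) :=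
    Real.logb_pos (by norm_num) (by have : (0:ℝ) ≤ Fintype.card A := by positivity
                                    linarith)
  have hn' : (0 : ℝ) < n := by exact_mod_cast hn
  have h := chernoff p hp (fun ω => Real.logb 2 (ratio p X Y ω))
    (fun ω h => Real.logb_nonneg (by norm_num) (one_le_ratio hp X Y ω h))
    _ (by positivity) (second_moment p hp _ (ratio_nonneg hp X Y) (one_le_ratio hp X Y) _
      (sum_ratio hp X Y))
    (Real.logb 2 ((Fintype.card A : ℝ) + 3) * Real.sqrt ((2 / (n : ℝ)) * x)) (by positivity) n
  rw [sum_log_ratio hp] at h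
  refine h.trans ?_
  rw [mul_pow, Real.sq_sqrt (by positivity), Real.rpow_def_of_pos (by norm_num), Real.exp_le_exp]
  have e : (n * (Real.logb 2 ((Fintype.card A : ℝ) + 3) ^ 2 * (2 / (n : ℝ) * x)) /
      (2 * Real.logb 2 ((Fintype.card A : ℝ) + 3) ^ 2)) = x := by field_simp
  rw [e]
  have : Real.log 2 ≤ 1 := by linarith [Real.log_two_lt_d9]
  nlinarith

section Seq

variable {D : ℕ} {𝒴 : Fin D → Type} [∀ d, Fintype (𝒴 d)] {𝒵 : Type} [Fintype 𝒵]

/-- swap the order of coordinates -/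
def seqE (𝒴 : Fin D → Type) (𝒵 : Type) (n : ℕ) :
    ((∀ d, Fin n → 𝒴 d) × (Fin n → 𝒵)) ≃ (Fin n → (∀ d, 𝒴 d) × 𝒵) where
  toFun ω i := (fun d => ω.1 d i, ω.2 i)
  invFun f := (fun d i => (f i).1 d, fun i => (f i).2)
  left_inv _ := rfl
  right_inv _ := rfl

lemma sum_seq (n : ℕ) (F : (Fin n → (∀ d, 𝒴 d) × 𝒵) → ℝ) :
    ∑ ω : (∀ d, Fin n → 𝒴 d) × (Fin n → 𝒵), F (fun i => (fun d => ω.1 d i, ω.2 i)) =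
      ∑ a, F a :=
  Equiv.sum_comp (seqE 𝒴 𝒵 n) F

lemma marg_eq (q : ((∀ d, 𝒴 d) × 𝒵) → ℝ) (n : ℕ) (S : Finset (Fin D))
    (ys : ∀ d : {d // d ∈ S}, Fin n → 𝒴 d.1) (zn : Fin n → 𝒵) :
    (∑ y : ∀ d, Fin n → 𝒴 d, if ∀ d : {d // d ∈ S}, y d.1 = ys d
      then ∏ i, q (fun d => y d i, zn i) else 0) =
    ∏ i, prob q (fun ω => ((fun (d : {d // d ∈ S}) => ω.1 d.1), ω.2)) (fun d => ys d i, zn i) := by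
  have h1 : ∀ i, prob q (fun ω => ((fun (d : {d // d ∈ S}) => ω.1 d.1), ω.2))
      (fun d => ys d i, zn i) = ∑ a : ∀ d, 𝒴 d,
        if (fun (d : {d // d ∈ S}) => a d.1) = (fun d => ys d i) then q (a, zn i) else 0 := by
    intro i
    rw [prob, Fintype.sum_prod_type]
    refine Finset.sum_congr rfl fun a _ => ?_
    simp only [Prod.mk.injEq]
    rw [Finset.sum_eq_single (zn i)]
    · simp
    · intro b _ hb; simp [hb]
    · simp
  simp only [h1]
  rw [← sum_pi_prod (fun i (a : ∀ d, 𝒴 d) =>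
    if (fun (d : {d // d ∈ S}) => a d.1) = (fun d => ys d i) then q (a, zn i) else 0),
    ← Equiv.sum_comp (Equiv.piComm (fun (d : Fin D) (_ : Fin n) => 𝒴 d))]
  refine Finset.sum_congr rfl fun y _ => ?_
  rw [Fintype.prod_ite_zero]
  have : (∀ d : {d // d ∈ S}, y d.1 = ys d) ↔
      ∀ i, (fun (d : {d // d ∈ S}) => (Equiv.piComm (fun (d : Fin D) (_ : Fin n) => 𝒴 d)) y i d.1)
        = (fun d => ys d i) := by
    simp only [funext_iff, Equiv.piComm_apply, Function.swap]
    exact forall_comm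
  by_cases h : ∀ d : {d // d ∈ S}, y d.1 = ys d
  · rw [if_pos h, if_pos (this.1 h)]; rfl
  · rw [if_neg h, if_neg (fun h' => h (this.2 h'))]

lemma prob_snd (q : ((∀ d, 𝒴 d) × 𝒵) → ℝ) (z : 𝒵) :
    prob q (fun ω => ω.2) z = ∑ yy : ∀ d, 𝒴 d, q (yy, z) := by
  rw [prob, Fintype.sum_prod_type]
  simp

lemma minent_ge (q : ((∀ d, 𝒴 d) × 𝒵) → ℝ) (hq : IsPMF q) (n : ℕ)
    (w : ((∀ d, Fin n → 𝒴 d) × (Fin n → 𝒵)) → ℝ) (hw : ∀ ω, 0 ≤ w ω)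
    (hle : ∀ ω, w ω ≤ ∏ i, q (fun d => ω.1 d i, ω.2 i)) (hpos : ∃ ω, 0 < w ω)
    (S : Finset (Fin D)) (T : ℝ)
    (hT : ∀ (ys : ∀ d : {d // d ∈ S}, Fin n → 𝒴 d.1) (zn : Fin n → 𝒵),
      (∑ y : ∀ d, Fin n → 𝒴 d,
        if ∀ d : {d // d ∈ S}, y d.1 = ys d then w (y, zn) else 0) ≤
      (2 : ℝ) ^ (-T) * ∏ i, ∑ yy : ∀ d, 𝒴 d, q (yy, zn i)) :
    T ≤ condMinEnt
              (fun (ys : ∀ d : {d // d ∈ S}, Fin n → 𝒴 d.1) (zn : Fin n → 𝒵) =>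
                ∑ y : ∀ d, Fin n → 𝒴 d,
                  if ∀ d : {d // d ∈ S}, y d.1 = ys d then w (y, zn) else 0)
              (fun zn => ∏ i, ∑ yy : ∀ d, 𝒴 d, q (yy, zn i)) := by
  have hz0 : ∀ zn : Fin n → 𝒵, 0 ≤ ∏ i, ∑ yy : ∀ d, 𝒴 d, q (yy, zn i) := fun zn =>
    Finset.prod_nonneg fun i _ => Finset.sum_nonneg fun y _ => hq.1 _
  rw [condMinEnt, le_neg]
  set s := {y : ℝ | ∃ (a : ∀ d : {d // d ∈ S}, Fin n → 𝒴 d.1) (z : Fin n → 𝒵),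
    (∏ i, ∑ yy : ∀ d, 𝒴 d, q (yy, z i)) ≠ 0 ∧ y =
    (∑ y : ∀ d, Fin n → 𝒴 d, if ∀ d : {d // d ∈ S}, y d.1 = a d then w (y, z) else 0) /
      ∏ i, ∑ yy : ∀ d, 𝒴 d, q (yy, z i)} with hs
  have hub : ∀ y ∈ s, y ≤ (2 : ℝ) ^ (-T) := by
    rintro y ⟨a, z, hz, rfl⟩
    rw [div_le_iff₀ ((hz0 z).lt_of_ne' hz)]
    exact hT a z
  obtain ⟨⟨y0, z0⟩, h0⟩ := hpos
  have hprod := h0.trans_le (hle _)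
  have hzp : 0 < ∏ i, ∑ yy : ∀ d, 𝒴 d, q (yy, z0 i) := by
    refine Finset.prod_pos fun i _ => ?_
    have h1 : q (fun d => y0 d i, z0 i) ≠ 0 := by
      have := Finset.prod_ne_zero_iff.1 hprod.ne' i (Finset.mem_univ i)
      exact this
    refine ((hq.1 _).lt_of_ne' h1).trans_le ?_
    exact Finset.single_le_sum (f := fun yy => q (yy, z0 i)) (fun _ _ => hq.1 _)
      (Finset.mem_univ (fun d => y0 d i))
  have hmem : ∃ y ∈ s, 0 < y := by
    refine ⟨_, ⟨fun d => y0 d.1, z0, hzp.ne', rfl⟩, div_pos ?_ hzp⟩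
    refine h0.trans_le ?_
    have := Finset.single_le_sum (f := fun y : ∀ d, Fin n → 𝒴 d =>
      if ∀ d : {d // d ∈ S}, y d.1 = y0 d.1 then w (y, z0) else 0)
      (fun y _ => by split_ifs <;> simp [hw]) (Finset.mem_univ y0)
    simpa using this
  obtain ⟨y, hy, hy0⟩ := hmem
  have hsp : 0 < sSup s := hy0.trans_le (le_csSup ⟨_, hub⟩ hy)
  have hsle : sSup s ≤ (2 : ℝ) ^ (-T) := csSup_le ⟨y, hy⟩ hub
  have := Real.logb_le_logb_of_le (b := 2) (by norm_num) hsp hsle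
  rwa [Real.logb_rpow (by norm_num) (by norm_num)] at this

lemma exists_pos_prod (q : ((∀ d, 𝒴 d) × 𝒵) → ℝ) (hq : IsPMF q) (n : ℕ) :
    ∑ ω : (∀ d, Fin n → 𝒴 d) × (Fin n → 𝒵), ∏ i, q (fun d => ω.1 d i, ω.2 i) = 1 := by
  rw [sum_seq n (fun a => ∏ i, q (a i)), sum_pi_prod (fun _ a => q a)]
  simp [hq.2]

end Seq

/-- **Lemma 2 (Min-entropy smoothing for i.i.d. sources).** For every pmf
`q` on `(∏ d, 𝒴 d) × 𝒵` and every `ε > 0`, there is a sub-normalized nonnegative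
function `w` on the `n`-fold product space, within variational distance `ε` of
the i.i.d. product `q^{⊗n}`, such that for every nonempty `S ⊆ 𝒟` the marginal
of `w` on `(∏ d ∈ S, 𝒴 d^n) × 𝒵^n` satisfies
`H∞(w_{Y_S^n Z^n} | q_{Z^n}) ≥ n H(Y_S | Z) − n δ_S(n)`. -/
theorem minentropy_smoothing
    {D : ℕ} {𝒴 : Fin D → Type} [∀ d, Fintype (𝒴 d)] [∀ d, Nonempty (𝒴 d)]
    {𝒵 : Type} [Fintype 𝒵] [Nonempty 𝒵]
    (q : ((∀ d, 𝒴 d) × 𝒵) → ℝ) (hq : IsPMF q) (n : ℕ) (ε : ℝ) (hε : 0 < ε) :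
    ∃ w : ((∀ d, Fin n → 𝒴 d) × (Fin n → 𝒵)) → ℝ,
      (∀ ω, 0 ≤ w ω) ∧
      (∑ ω : (∀ d, Fin n → 𝒴 d) × (Fin n → 𝒵), w ω ≤ 1) ∧
      (∑ ω : (∀ d, Fin n → 𝒴 d) × (Fin n → 𝒵),
        |(∏ i, q (fun d => ω.1 d i, ω.2 i)) - w ω|) ≤ ε ∧
      ∀ S : Finset (Fin D), S.Nonempty →
        (n : ℝ) * condEnt q (fun ω (d : {d // d ∈ S}) => ω.1 d.1) (fun ω => ω.2)
            - (n : ℝ) * (Real.logb 2 ((Fintype.card (∀ d : {d // d ∈ S}, 𝒴 d.1) : ℝ) + 3) *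
                Real.sqrt ((2 / (n : ℝ)) * ((D : ℝ) + Real.logb 2 (1 / ε))))
          ≤ condMinEnt
              (fun (ys : ∀ d : {d // d ∈ S}, Fin n → 𝒴 d.1) (zn : Fin n → 𝒵) =>
                ∑ y : ∀ d, Fin n → 𝒴 d,
                  if ∀ d : {d // d ∈ S}, y d.1 = ys d then w (y, zn) else 0)
              (fun zn => ∏ i, ∑ yy : ∀ d, 𝒴 d, q (yy, zn i)) := by

  set δ : Finset (Fin D) → ℝ := fun S =>
    Real.logb 2 ((Fintype.card (∀ d : {d // d ∈ S}, 𝒴 d.1) : ℝ) + 3) *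
                Real.sqrt ((2 / (n : ℝ)) * ((D : ℝ) + Real.logb 2 (1 / ε))) with hδ
  set H : Finset (Fin D) → ℝ := fun S =>
    condEnt q (fun ω (d : {d // d ∈ S}) => ω.1 d.1) (fun ω => ω.2) with hH
  set Q : ((∀ d, Fin n → 𝒴 d) × (Fin n → 𝒵)) → ℝ :=
    fun ω => ∏ i, q (fun d => ω.1 d i, ω.2 i) with hQ
  have hQ0 : ∀ ω, 0 ≤ Q ω := fun ω => Finset.prod_nonneg fun i _ => hq.1 _
  have hQ1 : ∑ ω, Q ω = 1 := exists_pos_prod q hq n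
  rcases le_or_gt 1 ε with h1 | h1
  · -- large `ε`: scale down
    set T := ∑ S : Finset (Fin D), |n * H S - n * δ S| with hT
    have hT0 : 0 ≤ T := Finset.sum_nonneg fun S _ => abs_nonneg _
    set c := (2 : ℝ) ^ (-T) with hc
    have hc0 : 0 < c := by positivity
    have hc1 : c ≤ 1 := Real.rpow_le_one_of_one_le_of_nonpos (by norm_num) (by linarith)
    have hle : ∀ ω, c * Q ω ≤ Q ω := fun ω => mul_le_of_le_one_left (hQ0 ω) hc1
    refine ⟨fun ω => c * Q ω, fun ω => mul_nonneg hc0.le (hQ0 ω), ?_, ?_, ?_⟩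
    · rw [← Finset.mul_sum, hQ1]; linarith
    · calc ∑ ω, |Q ω - c * Q ω| = ∑ ω, (1 - c) * Q ω := by
            refine Finset.sum_congr rfl fun ω _ => ?_
            rw [abs_of_nonneg (by linarith [hle ω])]; ring
        _ ≤ ε := by rw [← Finset.mul_sum, hQ1]; linarith
    · intro S _
      refine minent_ge q hq n _ (fun ω => mul_nonneg hc0.le (hQ0 ω)) hle ?_ S _ ?_
      · by_contra! hcon
        have : ∑ ω, c * Q ω ≤ 0 := Finset.sum_nonpos fun ω _ => hcon ω
        rw [← Finset.mul_sum, hQ1] at this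
        linarith
      · intro ys zn
        have hm := marg_eq q n S ys zn
        have e : (∑ y : ∀ d, Fin n → 𝒴 d, if ∀ d : {d // d ∈ S}, y d.1 = ys d
            then c * Q (y, zn) else 0) = c * ∏ i, prob q
            (fun ω => ((fun (d : {d // d ∈ S}) => ω.1 d.1), ω.2)) (fun d => ys d i, zn i) := by
          rw [← hm, Finset.mul_sum]
          refine Finset.sum_congr rfl fun y _ => ?_
          rw [mul_ite, mul_zero]
        rw [e]
        refine mul_le_mul ?_ ?_ (Finset.prod_nonneg fun i _ => prob_nonneg hq _ _) (by positivity)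
        · refine Real.rpow_le_rpow_of_exponent_le (by norm_num) (neg_le_neg ?_)
          refine (le_abs_self _).trans ?_
          exact Finset.single_le_sum (f := fun S => |n * H S - n * δ S|)
            (fun S _ => abs_nonneg _) (Finset.mem_univ S)
        · refine Finset.prod_le_prod (fun i _ => prob_nonneg hq _ _) fun i _ => ?_
          rw [← prob_snd]
          exact prob_pair_le hq (fun ω (d : {d // d ∈ S}) => ω.1 d.1) (fun ω => ω.2) _ _
  · -- main case
    set R : Finset (Fin D) → (∀ d, 𝒴 d) × 𝒵 → ℝ := fun S =>
      ratio q (fun ω (d : {d // d ∈ S}) => ω.1 d.1) (fun ω => ω.2) with hR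
    set bad : Finset (Fin D) → ((∀ d, Fin n → 𝒴 d) × (Fin n → 𝒵)) → Prop := fun S ω =>
      ∑ i, Real.logb 2 (R S (fun d => ω.1 d i, ω.2 i)) < n * H S - n * δ S with hbad
    have hx : 0 ≤ (D : ℝ) + Real.logb 2 (1 / ε) := by
      have : 0 ≤ Real.logb 2 (1 / ε) :=
        Real.logb_nonneg (by norm_num) (by rw [le_div_iff₀ hε]; linarith)
      positivity
    have hb : ∀ S, ∑ ω, (if bad S ω then Q ω else 0) ≤ ((2 : ℝ) ^ D)⁻¹ * ε := by
      intro S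
      have h := aep hq (fun ω (d : {d // d ∈ S}) => ω.1 d.1) (fun ω => ω.2) n _ hx
      rw [← sum_seq] at h
      refine h.trans_eq ?_
      rw [neg_add, Real.rpow_add (by norm_num), Real.rpow_neg (by norm_num), Real.rpow_natCast,
        Real.logb_div (by norm_num) hε.ne', Real.logb_one, zero_sub, neg_neg,
        Real.rpow_logb (by norm_num) (by norm_num) hε]
    set w : ((∀ d, Fin n → 𝒴 d) × (Fin n → 𝒵)) → ℝ := fun ω =>
      if ∃ S, bad S ω then 0 else Q ω with hw
    have hw0 : ∀ ω, 0 ≤ w ω := fun ω => by simp only [hw]; split_ifs <;> simp [hQ0]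
    have hwle : ∀ ω, w ω ≤ Q ω := fun ω => by simp only [hw]; split_ifs <;> simp [hQ0]
    have hV : ∑ ω, |Q ω - w ω| ≤ ε := by
      calc ∑ ω, |Q ω - w ω| ≤ ∑ ω, ∑ S, (if bad S ω then Q ω else 0) := by
            refine Finset.sum_le_sum fun ω _ => ?_
            have hnn : ∀ S ∈ (Finset.univ : Finset (Finset (Fin D))),
                0 ≤ (if bad S ω then Q ω else 0) := fun S _ => by
              split_ifs <;> simp [hQ0]
            by_cases h : ∃ S, bad S ω
            · have e : w ω = 0 := if_pos h
              rw [e, sub_zero, abs_of_nonneg (hQ0 ω)]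
              obtain ⟨S, hS⟩ := h
              have := Finset.single_le_sum hnn (Finset.mem_univ S)
              rwa [if_pos hS] at this
            · have e : w ω = Q ω := if_neg h
              rw [e, sub_self, abs_zero]
              exact Finset.sum_nonneg hnn
        _ = ∑ S, ∑ ω, (if bad S ω then Q ω else 0) := Finset.sum_comm
        _ ≤ ∑ S : Finset (Fin D), ((2 : ℝ) ^ D)⁻¹ * ε := Finset.sum_le_sum fun S _ => hb S
        _ = ε := by simp
    refine ⟨w, hw0, (Finset.sum_le_sum fun ω _ => hwle ω).trans hQ1.le, hV, ?_⟩
    intro S _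
    refine minent_ge q hq n w hw0 hwle ?_ S _ ?_
    · by_contra! hcon
      have e : ∑ ω, |Q ω - w ω| = ∑ ω, Q ω := by
        refine Finset.sum_congr rfl fun ω _ => ?_
        rw [le_antisymm (hcon ω) (hw0 ω), sub_zero, abs_of_nonneg (hQ0 ω)]
      rw [e, hQ1] at hV
      linarith
    · intro ys zn
      by_cases hall : ∀ y : ∀ d, Fin n → 𝒴 d, (∀ d : {d // d ∈ S}, y d.1 = ys d) → w (y, zn) = 0
      · rw [Finset.sum_eq_zero]
        · exact mul_nonneg (by positivity)
            (Finset.prod_nonneg fun i _ => Finset.sum_nonneg fun y _ => hq.1 _)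
        · intro y _
          split_ifs with h
          · exact hall y h
          · rfl
      push Not at hall
      obtain ⟨y, hy, hwy⟩ := hall
      have hg : ¬ bad S (y, zn) := fun h => hwy (if_pos ⟨S, h⟩)
      have hQp : Q (y, zn) ≠ 0 := by
        have := hwle (y, zn)
        have := (hw0 (y, zn)).lt_of_ne' hwy
        linarith
      have hqi : ∀ i, 0 < q (fun d => y d i, zn i) := fun i =>
        (hq.1 _).lt_of_ne' (Finset.prod_ne_zero_iff.1 hQp i (Finset.mem_univ i))
      have hm := marg_eq q n S ys zn
      have hle : (∑ y : ∀ d, Fin n → 𝒴 d, if ∀ d : {d // d ∈ S}, y d.1 = ys d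
            then w (y, zn) else 0) ≤ ∏ i, prob q
            (fun ω => ((fun (d : {d // d ∈ S}) => ω.1 d.1), ω.2)) (fun d => ys d i, zn i) := by
        rw [← hm]
        refine Finset.sum_le_sum fun y _ => ?_
        split_ifs
        · exact hwle _
        · exact le_rfl
      refine hle.trans ?_
      have hRp : ∀ i, 0 < R S (fun d => y d i, zn i) := fun i =>
        zero_lt_one.trans_le (one_le_ratio hq _ _ _ (hqi i))
      have hterm : ∀ i, prob q
            (fun ω => ((fun (d : {d // d ∈ S}) => ω.1 d.1), ω.2)) (fun d => ys d i, zn i) =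
          (2 : ℝ) ^ (-Real.logb 2 (R S (fun d => y d i, zn i))) *
            ∑ yy : ∀ d, 𝒴 d, q (yy, zn i) := by
        intro i
        rw [Real.rpow_neg (by norm_num), Real.rpow_logb (by norm_num) (by norm_num) (hRp i),
          ← prob_snd, eq_inv_mul_iff_mul_eq₀ (hRp i).ne']
        have hyi : (fun (d : {d // d ∈ S}) => ys d i) = fun (d : {d // d ∈ S}) => y d.1 i := by
          funext d; rw [hy d]
        rw [hyi]
        have hp := (hqi i).trans_le
          (le_prob hq (fun ω => ((fun (d : {d // d ∈ S}) => ω.1 d.1), ω.2)) _)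
        exact div_mul_cancel₀ _ hp.ne'
      rw [Finset.prod_congr rfl fun i _ => hterm i, Finset.prod_mul_distrib]
      refine mul_le_mul_of_nonneg_right ?_
        (Finset.prod_nonneg fun i _ => Finset.sum_nonneg fun y _ => hq.1 _)
      rw [← Real.rpow_sum_of_pos (by norm_num)]
      refine Real.rpow_le_rpow_of_exponent_le (by norm_num) ?_
      rw [Finset.sum_neg_distrib]
      exact neg_le_neg (not_lt.1 hg)

end SecretSharing
end
end

section
/- Distributed collision probability bound (key step in the proof of Lemma 1): let ℒ = {1,…,L}, let 𝒳_l (l ∈ ℒ) be finite alphabets, and let X = (X_l)_{l∈ℒ} and X' = (X'_l)_{l∈ℒ} be i.i.d. random vectors with pmf p_{X_ℒ} on ∏_{l∈ℒ}𝒳_l. For each l ∈ ℒ let F_l be uniformly distributed on a two-universal family of functions 𝒳_l → {0,1}^{r_l}, independently across l and independently of (X, X'). Then P[ F_l(X_l) = F_l(X'_l) for all l ∈ ℒ ] ≤ Σ_{S ⊆ ℒ} 2^{ −r_S − H∞(p_{X_{S^c}}) }, where the sum runs over all subsets S of ℒ (including S = ∅ and S = ℒ), r_S = Σ_{l∈S}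 r_l with r_∅ = 0, p_{X_{S^c}} is the marginal of p_{X_ℒ} on the coordinates outside S, and H∞(p) ≜ −log₂ max p, with the convention H∞ of the empty marginal equal to 0. -/
open scoped BigOperators
open Finset Filter

noncomputable section

namespace SecretSharing

open scoped Classical

/-! ### Basic Shannon information quantities (base 2) on finite probability spaces -/

variable {Ω : Type*} [Fintype Ω]

theorem sum_collision {L : ℕ} {F : Fin L → Type} [∀ l, Fintype (F l)]
    (P : ∀ l, F l → Prop) (a : ℝ) :
    (∏ l, (Fintype.card (F l) : ℝ))⁻¹ * ∑ f : ∀ l, F l, (if ∀ l, P l (f l) then a else 0)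
      = a * ∏ l, (((Finset.univ.filter (P l)).card : ℝ) / (Fintype.card (F l) : ℝ)) := by
  have h1 : ∏ l, ((Finset.univ.filter (P l)).card : ℝ)
      = ∑ f : ∀ l, F l, (if ∀ l, P l (f l) then (1 : ℝ) else 0) := by
    have h2 : ∀ l, ((Finset.univ.filter (P l)).card : ℝ) = ∑ j : F l, if P l j then (1 : ℝ) else 0 := by
      intro l; simp
    simp_rw [h2]
    rw [Finset.prod_univ_sum, Fintype.piFinset_univ]
    refine Finset.sum_congr rfl fun f _ => ?_
    rw [Finset.prod_ite_zero]
    simp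
  have h3 : ∑ f : ∀ l, F l, (if ∀ l, P l (f l) then a else 0)
      = a * ∑ f : ∀ l, F l, (if ∀ l, P l (f l) then (1 : ℝ) else 0) := by
    rw [Finset.mul_sum]
    refine Finset.sum_congr rfl fun f _ => ?_
    split_ifs <;> simp
  rw [Finset.prod_div_distrib, h1, h3]
  ring

theorem two_rpow_minEnt {A : Type*} [Fintype A] (w : A → ℝ) (R : ℝ) (a : A) (ha : 0 < w a) :
    (2 : ℝ) ^ (-R - minEnt w) = (2 : ℝ) ^ (-R) * sSup (Set.range w) := by
  have h : 0 < sSup (Set.range w) :=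
    lt_of_lt_of_le ha (le_csSup (Set.finite_range w).bddAbove ⟨a, rfl⟩)
  unfold minEnt
  rw [sub_neg_eq_add, Real.rpow_add two_pos, Real.rpow_logb two_pos (by norm_num) h]

/-- **Distributed collision probability bound (key step in the proof of
Lemma 1).** For i.i.d. `X, X'` with pmf `p` and independent uniformly chosen
two-universal hashes `F_l`,
`P[∀ l, F_l(X_l) = F_l(X'_l)] ≤ Σ_{S ⊆ ℒ} 2^{−r_S − H∞(p_{X_{Sᶜ}})}`. -/
theorem distributed_collision_bound
    {L : ℕ} {𝒳 : Fin L → Type} [∀ l, Fintype (𝒳 l)] [∀ l, Nonempty (𝒳 l)]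
    (p : (∀ l, 𝒳 l) → ℝ) (hp : IsPMF p)
    (r : Fin L → ℕ) (F : Fin L → Type) [∀ l, Fintype (F l)] [∀ l, Nonempty (F l)]
    (ev : ∀ l, F l → 𝒳 l → (Fin (r l) → Bool))
    (huniv : ∀ l, TwoUniversal (F l) (ev l)) :
    (∏ l, (Fintype.card (F l) : ℝ))⁻¹ *
      ∑ f : ∀ l, F l, ∑ x : ∀ l, 𝒳 l, ∑ x' : ∀ l, 𝒳 l,
        (if ∀ l, ev l (f l) (x l) = ev l (f l) (x' l) then p x * p x' else 0)
    ≤ ∑ S : Finset (Fin L),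
        (2 : ℝ) ^ (-(∑ l ∈ S, (r l : ℝ)) -
          minEnt (fun xs : ∀ l : {l // l ∈ Sᶜ}, 𝒳 l.1 =>
            ∑ x : ∀ l, 𝒳 l,
              if ∀ l : {l // l ∈ Sᶜ}, x l.1 = xs l then p x else 0)) := by
  obtain ⟨hp0, hp1⟩ := hp
  obtain ⟨x0, hx0⟩ : ∃ x, 0 < p x := by
    by_contra hcon
    push Not at hcon
    have : ∑ x, p x ≤ 0 := Finset.sum_nonpos fun x _ => hcon x
    linarith
  -- rewrite right-hand side
  have hR : ∀ S : Finset (Fin L), (2 : ℝ) ^ (-(∑ l ∈ S, (r l : ℝ)) -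
          minEnt (fun xs : ∀ l : {l // l ∈ Sᶜ}, 𝒳 l.1 =>
            ∑ x : ∀ l, 𝒳 l,
              if ∀ l : {l // l ∈ Sᶜ}, x l.1 = xs l then p x else 0)) ≥
      ∑ x : ∀ l, 𝒳 l, ∑ x' : ∀ l, 𝒳 l, p x * p x' *
        (if ∀ l, l ∉ S → x' l = x l then ∏ l ∈ S, ((2 : ℝ) ^ (r l))⁻¹ else 0) := by
    intro S
    set w := (fun xs : ∀ l : {l // l ∈ Sᶜ}, 𝒳 l.1 =>
            ∑ x : ∀ l, 𝒳 l,
              if ∀ l : {l // l ∈ Sᶜ}, x l.1 = xs l then p x else 0) with hw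
    have hpos : 0 < w (fun l => x0 l.1) := by
      rw [hw]
      refine lt_of_lt_of_le ?_ (Finset.single_le_sum (f := fun x : ∀ l, 𝒳 l =>
        if ∀ l : {l // l ∈ Sᶜ}, x l.1 = x0 l.1 then p x else 0) ?_ (Finset.mem_univ x0))
      · simpa using hx0
      · intro x _
        split_ifs
        · exact hp0 x
        · exact le_rfl
    rw [two_rpow_minEnt w _ _ hpos]
    have h2 : (2 : ℝ) ^ (-(∑ l ∈ S, (r l : ℝ))) = ∏ l ∈ S, ((2 : ℝ) ^ (r l))⁻¹ := by
      rw [Real.rpow_neg two_pos.le, ← Nat.cast_sum, Real.rpow_natCast,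
        ← Finset.prod_pow_eq_pow_sum, Finset.prod_inv_distrib]
    rw [h2]
    set c := ∏ l ∈ S, ((2 : ℝ) ^ (r l))⁻¹ with hc
    have hc0 : 0 ≤ c := Finset.prod_nonneg fun l _ => by positivity
    have hx : ∀ x : ∀ l, 𝒳 l, ∑ x' : ∀ l, 𝒳 l, p x * p x' *
        (if ∀ l, l ∉ S → x' l = x l then c else 0) = p x * (c * w (fun l => x l.1)) := by
      intro x
      rw [hw]
      simp only [Finset.mul_sum]
      refine Finset.sum_congr rfl fun x' _ => ?_
      by_cases h : ∀ l, l ∉ S → x' l = x l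
      · have h' : ∀ l : {l // l ∈ Sᶜ}, x' l.1 = x l.1 :=
          fun l => h l.1 (Finset.mem_compl.1 l.2)
        rw [if_pos h, if_pos h']; ring
      · have h' : ¬ ∀ l : {l // l ∈ Sᶜ}, x' l.1 = x l.1 :=
          fun hh => h fun l hl => hh ⟨l, Finset.mem_compl.2 hl⟩
        rw [if_neg h, if_neg h']; ring
    rw [ge_iff_le]
    calc _ = ∑ x, p x * (c * w (fun l => x l.1)) := Finset.sum_congr rfl fun x _ => hx x
      _ ≤ ∑ x, p x * (c * sSup (Set.range w)) := by
        refine Finset.sum_le_sum fun x _ => ?_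
        refine mul_le_mul_of_nonneg_left (mul_le_mul_of_nonneg_left ?_ hc0) (hp0 x)
        exact le_csSup (Set.finite_range w).bddAbove ⟨_, rfl⟩
      _ = c * sSup (Set.range w) := by rw [← Finset.sum_mul, hp1, one_mul]
  refine le_trans ?_ (Finset.sum_le_sum fun S _ => hR S)
  -- left-hand side
  rw [Finset.sum_comm, Finset.mul_sum, Finset.sum_comm]
  refine Finset.sum_le_sum fun x _ => ?_
  rw [Finset.sum_comm, Finset.mul_sum, Finset.sum_comm]
  refine Finset.sum_le_sum fun x' _ => ?_
  have hcol := sum_collision (fun l f => ev l f (x l) = ev l f (x' l)) (p x * p x')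
  refine le_trans (le_of_eq (Eq.trans ?_ hcol)) ?_
  · congr! 3
  rw [← Finset.mul_sum]
  refine mul_le_mul_of_nonneg_left ?_ (mul_nonneg (hp0 _) (hp0 _))
  let T : Finset (Fin L) := Finset.univ.filter fun l => x l ≠ x' l
  have hT : ∀ l, l ∉ T → x' l = x l := by
    intro l hl
    by_contra hne
    exact hl (Finset.mem_filter.2 ⟨Finset.mem_univ l, fun h => hne h.symm⟩)
  calc _ ≤ ∏ l, (if l ∈ T then ((2 : ℝ) ^ (r l))⁻¹ else 1) := by
        refine Finset.prod_le_prod (fun l _ => by positivity) fun l _ => ?_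
        by_cases hl : l ∈ T
        · rw [if_pos hl]
          have := huniv l (x l) (x' l) (Finset.mem_filter.1 hl).2
          refine le_trans (le_of_eq ?_) this
          congr!
        · rw [if_neg hl]
          refine div_le_one_of_le₀ ?_ (by positivity)
          exact_mod_cast Finset.card_le_univ _
    _ = ∏ l ∈ T, ((2 : ℝ) ^ (r l))⁻¹ := by
        rw [Finset.prod_ite_mem, Finset.univ_inter]
    _ = (if ∀ l, l ∉ T → x' l = x l then ∏ l ∈ T, ((2 : ℝ) ^ (r l))⁻¹ else 0) := by
        rw [if_pos hT]
    _ ≤ _ := by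
        refine Finset.single_le_sum (f := fun S : Finset (Fin L) =>
          if ∀ l, l ∉ S → x' l = x l then ∏ l ∈ S, ((2 : ℝ) ^ (r l))⁻¹ else 0) ?_ (Finset.mem_univ T)
        intro S _
        split_ifs
        · exact Finset.prod_nonneg fun l _ => by positivity
        · exact le_rfl

end SecretSharing
end
end

section
/- Converse bound for the pairwise-keys source (key step in the proof of Theorem 7): in the pairwise-keys model, for every t ∈ {1,…,L}, z ∈ {1,…,t−1}, and every subset S ⊆ 𝒟: min over A ⊆ ℒ with |A| ≥ t and U ⊆ ℒ with |U| ≤ z of I( Y_S ; X_A, Y_{S^c} | X_U ) ≤ |S|·(t − z), where mutual information is in base 2. -/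
open scoped BigOperators
open Finset Filter

noncomputable section

namespace SecretSharing

open scoped Classical

/-! ### Basic Shannon information quantities (base 2) on finite probability spaces -/

variable {Ω : Type*} [Fintype Ω]

/-! ### The distributed secret-sharing model -/

variable {L D : ℕ} {𝒳 : Fin L → Type} {𝒴 : Fin D → Type}
variable [∀ l, Fintype (𝒳 l)] [∀ d, Fintype (𝒴 d)]

/-- Sample space for one source symbol: the participants' observations and the
sub-dealers' observations. -/
abbrev Base (𝒳 : Fin L → Type) (𝒴 : Fin D → Type) : Type := (∀ l, 𝒳 l) × (∀ d, 𝒴 d)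

/-- The i.i.d. product pmf of `p` over `n` source symbols. -/
def iid (p : Base 𝒳 𝒴 → ℝ) (n : ℕ) : (Fin n → Base 𝒳 𝒴) → ℝ :=
  fun ω => ∏ i, p (ω i)

/-- Observations `X_T` of the set `T` of participants (single symbol). -/
def XT (T : Finset (Fin L)) : Base 𝒳 𝒴 → ∀ l : {l // l ∈ T}, 𝒳 l.1 :=
  fun ω l => ω.1 l.1

/-- Observations `Y_S` of the set `S` of sub-dealers (single symbol). -/
def YS (S : Finset (Fin D)) : Base 𝒳 𝒴 → ∀ d : {d // d ∈ S}, 𝒴 d.1 :=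
  fun ω d => ω.2 d.1

/-- Observations `X_T^n` of the set `T` of participants over a block of length `n`. -/
def XTn (T : Finset (Fin L)) (n : ℕ) :
    (Fin n → Base 𝒳 𝒴) → ∀ l : {l // l ∈ T}, Fin n → 𝒳 l.1 :=
  fun ω l i => (ω i).1 l.1

/-- Cardinality `⌈2^{n R_d}⌉` of the secret alphabet of sub-dealer `d`. -/
def secCard (R : Fin D → ℝ) (n : ℕ) (d : Fin D) : ℕ := ⌈(2:ℝ) ^ ((n : ℝ) * R d)⌉₊

/-- A secret-sharing strategy at blocklength `n` with rates `R`, for the access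
structure `𝔸`: public messages, secrets, and decoders for authorized sets. -/
structure Strategy (𝒳 : Fin L → Type) (𝒴 : Fin D → Type)
    (𝔸 : Set (Finset (Fin L))) (R : Fin D → ℝ) (n : ℕ) where
  msgCard : Fin D → ℕ
  encM : ∀ d : Fin D, (Fin n → 𝒴 d) → Fin (msgCard d)
  encS : ∀ d : Fin D, (Fin n → 𝒴 d) → Fin (secCard R n d)
  dec : ∀ A : Finset (Fin L), A ∈ 𝔸 →
    (∀ l : {l // l ∈ A}, Fin n → 𝒳 l.1) → (∀ d, Fin (msgCard d)) →
      ∀ d, Fin (secCard R n d)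

variable {𝔸 : Set (Finset (Fin L))} {R : Fin D → ℝ} {n : ℕ}

/-- The public communication `M_𝒟` as a random variable. -/
def Strategy.Mrv (σ : Strategy 𝒳 𝒴 𝔸 R n) :
    (Fin n → Base 𝒳 𝒴) → ∀ d, Fin (σ.msgCard d) :=
  fun ω d => σ.encM d (fun i => (ω i).2 d)

/-- The secrets `S_𝒟` as a random variable. -/
def Strategy.Srv (σ : Strategy 𝒳 𝒴 𝔸 R n) :
    (Fin n → Base 𝒳 𝒴) → ∀ d, Fin (secCard R n d) :=
  fun ω d => σ.encS d (fun i => (ω i).2 d)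

/-- The estimate `Ŝ_𝒟(A)` computed by the authorized set `A`. -/
def Strategy.ShatRv (σ : Strategy 𝒳 𝒴 𝔸 R n) (A : Finset (Fin L)) (hA : A ∈ 𝔸) :
    (Fin n → Base 𝒳 𝒴) → ∀ d, Fin (secCard R n d) :=
  fun ω => σ.dec A hA (fun l i => (ω i).1 l.1) (σ.Mrv ω)

/-- Error probability `P[Ŝ_𝒟(A) ≠ S_𝒟]`. -/
def Strategy.err (p : Base 𝒳 𝒴 → ℝ) (σ : Strategy 𝒳 𝒴 𝔸 R n)
    (A : Finset (Fin L)) (hA : A ∈ 𝔸) : ℝ :=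
  ∑ ω : Fin n → Base 𝒳 𝒴, if σ.ShatRv A hA ω ≠ σ.Srv ω then iid p n ω else 0

/-- Information leakage `I(S_𝒟 ; M_𝒟, X_U^n)` to the set `U` of participants. -/
def Strategy.leak (p : Base 𝒳 𝒴 → ℝ) (σ : Strategy 𝒳 𝒴 𝔸 R n)
    (U : Finset (Fin L)) : ℝ :=
  mutInf (iid p n) σ.Srv (fun ω => (σ.Mrv ω, XTn U n ω))

/-- Uniformity defect `log₂|𝒮_𝒟| - H(S_𝒟)`. -/
def Strategy.unif (p : Base 𝒳 𝒴 → ℝ) (σ : Strategy 𝒳 𝒴 𝔸 R n) : ℝ :=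
  Real.logb 2 (∏ d, (secCard R n d : ℝ)) - ent (iid p n) σ.Srv

/-- Achievability of the rate tuple `R` for access structure `𝔸` and
unauthorized sets `𝕌`: a sequence of strategies with vanishing error
probability (for every authorized set), vanishing leakage (for every
unauthorized set), and vanishing uniformity defect. -/
def Achievable (p : Base 𝒳 𝒴 → ℝ) (𝔸 𝕌 : Set (Finset (Fin L)))
    (R : Fin D → ℝ) : Prop :=
  (∀ d, 0 ≤ R d) ∧
  ∃ σ : (n : ℕ) → Strategy 𝒳 𝒴 𝔸 R n,
    (∀ A : Finset (Fin L), ∀ hA : A ∈ 𝔸,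
      Tendsto (fun n => (σ n).err p A hA) atTop (nhds 0)) ∧
    (∀ U ∈ 𝕌, Tendsto (fun n => (σ n).leak p U) atTop (nhds 0)) ∧
    Tendsto (fun n => (σ n).unif p) atTop (nhds 0)

/-- `𝔸` is a monotone access structure: nonempty, not containing `∅`, and
closed under taking supersets. -/
def MonotoneAccess (𝔸 : Set (Finset (Fin L))) : Prop :=
  𝔸.Nonempty ∧ ∅ ∉ 𝔸 ∧ ∀ A ∈ 𝔸, ∀ T : Finset (Fin L), A ⊆ T → T ∈ 𝔸

/-- The pairwise-keys source: each participant `l` and sub-dealer `d` share an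
independent uniform key bit `K_{l,d}`; participant `l` observes `X_l = (K_{l,d})_d`
and sub-dealer `d` observes `Y_d = (K_{l,d})_l`. -/
def pairKeyPMF (L D : ℕ) :
    Base (fun _ : Fin L => Fin D → Bool) (fun _ : Fin D => Fin L → Bool) → ℝ :=
  fun ω => if ∀ (l : Fin L) (d : Fin D), ω.1 l d = ω.2 d l
    then ((1 : ℝ) / 2) ^ (L * D) else 0

/-- The sample point determined by a key matrix. -/
def keyPt {L D : ℕ} (k : Fin L × Fin D → Bool) :
    Base (fun _ : Fin L => Fin D → Bool) (fun _ : Fin D => Fin L → Bool) :=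
  (fun l d => k (l, d), fun d l => k (l, d))

lemma keyPt_injective {L D : ℕ} : Function.Injective (keyPt (L := L) (D := D)) := by
  intro k k' h
  funext e
  have := congrFun (congrFun (congrArg Prod.fst h) e.1) e.2
  simpa [keyPt] using this

lemma sum_pairKey {L D : ℕ}
    (P : Base (fun _ : Fin L => Fin D → Bool) (fun _ : Fin D => Fin L → Bool) → Prop) :
    (∑ ω, if P ω then pairKeyPMF L D ω else 0)
      = ((univ.filter fun k : Fin L × Fin D → Bool => P (keyPt k)).card : ℝ)
          * ((1 : ℝ) / 2) ^ (L * D) := by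
  have h : (∑ k : Fin L × Fin D → Bool, if P (keyPt k) then ((1 : ℝ) / 2) ^ (L * D) else 0)
      = ∑ ω, if P ω then pairKeyPMF L D ω else 0 := by
    refine Fintype.sum_of_injective keyPt keyPt_injective _ _ ?_ ?_
    · intro ω hω
      have : ¬ ∀ (l : Fin L) (d : Fin D), ω.1 l d = ω.2 d l := by
        intro hc
        apply hω
        refine ⟨fun e => ω.1 e.1 e.2, ?_⟩
        refine Prod.ext rfl ?_
        funext d l
        exact hc l d
      simp [pairKeyPMF, this]
    · intro k
      simp [pairKeyPMF, keyPt]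
  rw [← h, ← Finset.sum_filter, Finset.sum_const, nsmul_eq_mul]

lemma card_agree {ι : Type*} [Fintype ι] (E : Finset ι) (k0 : ι → Bool) :
    (univ.filter fun k : ι → Bool => ∀ e ∈ E, k e = k0 e).card
      = 2 ^ (Fintype.card ι - E.card) := by
  have : (univ.filter fun k : ι → Bool => ∀ e ∈ E, k e = k0 e)
      = Fintype.piFinset (fun e => if e ∈ E then {k0 e} else univ) := by
    ext k
    simp only [mem_filter, mem_univ, true_and, Fintype.mem_piFinset]
    refine forall_congr' fun e => ?_
    by_cases he : e ∈ E <;> simp [he]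
  rw [this, Fintype.card_piFinset, ← Finset.card_compl, ← Finset.prod_const,
    ← Finset.prod_mul_prod_compl E]
  rw [Finset.prod_eq_one, one_mul]
  · refine Finset.prod_congr rfl fun e he => ?_
    simp [Finset.mem_compl.1 he]
  · intro e he
    simp [he]

lemma ent_pairKey {L D : ℕ} {B : Type*} [Fintype B]
    (V : Base (fun _ : Fin L => Fin D → Bool) (fun _ : Fin D => Fin L → Bool) → B)
    (E : Finset (Fin L × Fin D))
    (hV : ∀ k k', V (keyPt k) = V (keyPt k') ↔ ∀ e ∈ E, k e = k' e) :
    ent (pairKeyPMF L D) V = E.card := by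
  have hE : E.card ≤ L * D := by simpa using Finset.card_le_univ E
  have hp : ∀ b, prob (pairKeyPMF L D) V b = 0 ∨
      prob (pairKeyPMF L D) V b = (2 : ℝ) ^ (-(E.card : ℝ)) := by
    intro b
    by_cases hb : ∃ k0, V (keyPt k0) = b
    · right
      obtain ⟨k0, rfl⟩ := hb
      unfold prob
      rw [sum_pairKey (fun ω => V ω = V (keyPt k0))]
      have hc : (univ.filter fun k : Fin L × Fin D → Bool =>
          V (keyPt k) = V (keyPt k0)).card = 2 ^ (Fintype.card (Fin L × Fin D) - E.card) := by
        rw [← card_agree E k0]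
        congr 1
        ext k
        simp only [mem_filter, mem_univ, true_and, hV]
      rw [hc]
      simp only [Fintype.card_prod, Fintype.card_fin]
      rw [Real.rpow_neg (by norm_num), Real.rpow_natCast]
      obtain ⟨m, hm⟩ := Nat.exists_eq_add_of_le hE
      rw [hm, Nat.add_sub_cancel_left, pow_add]
      push_cast
      simp only [one_div, inv_pow]
      field_simp
    · left
      unfold prob
      rw [sum_pairKey (fun ω => V ω = b)]
      have : (univ.filter fun k : Fin L × Fin D → Bool => V (keyPt k) = b) = ∅ := by
        ext k
        simp only [mem_filter, mem_univ, true_and, notMem_empty, iff_false]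
        exact fun h => hb ⟨k, h⟩
      rw [this]
      simp
  have hs : ∑ b, prob (pairKeyPMF L D) V b = 1 := by
    unfold prob
    rw [Finset.sum_comm]
    simp only [Finset.sum_ite_eq, mem_univ, if_true]
    have := sum_pairKey (L := L) (D := D) (fun _ => True)
    simp only [if_true] at this
    rw [this]
    simp
  have : ∀ b, prob (pairKeyPMF L D) V b * Real.logb 2 (prob (pairKeyPMF L D) V b)
      = prob (pairKeyPMF L D) V b * (-(E.card : ℝ)) := by
    intro b
    rcases hp b with h | h
    · simp [h]
    · rw [h, Real.logb_rpow (by norm_num) (by norm_num)]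
  unfold ent
  rw [Finset.sum_congr rfl (fun b _ => this b), ← Finset.sum_mul, hs]
  ring

lemma XT_key {L D : ℕ} (T : Finset (Fin L)) (k k' : Fin L × Fin D → Bool) :
    (XT T (keyPt k) = XT T (keyPt k')) ↔ ∀ l ∈ T, ∀ d, k (l, d) = k' (l, d) := by
  simp [funext_iff, XT, keyPt]

lemma YS_key {L D : ℕ} (S : Finset (Fin D)) (k k' : Fin L × Fin D → Bool) :
    (YS S (keyPt k) = YS S (keyPt k')) ↔ ∀ d ∈ S, ∀ l, k (l, d) = k' (l, d) := by
  simp [funext_iff, YS, keyPt]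

/-- **Key step in the converse of Theorem 7.** For the pairwise-keys source,
`min_{|A| ≥ t} min_{|U| ≤ z} I(Y_S ; X_A, Y_{Sᶜ} | X_U) ≤ |S|(t − z)`. -/
theorem pairwise_keys_converse_bound
    {L D : ℕ} (hL : 1 ≤ L) (hD : 1 ≤ D) (t z : ℕ)
    (ht1 : 1 ≤ t) (htL : t ≤ L) (hz1 : 1 ≤ z) (hzt : z < t)
    (S : Finset (Fin D)) :
    ∃ A : Finset (Fin L), t ≤ A.card ∧ ∃ U : Finset (Fin L), U.card ≤ z ∧
      condMutInf (pairKeyPMF L D) (YS S) (fun ω => (XT A ω, YS Sᶜ ω)) (XT U)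
        ≤ (S.card : ℝ) * ((t : ℝ) - (z : ℝ)) := by
  obtain ⟨A, -, hA⟩ := Finset.exists_subset_card_eq (s := (univ : Finset (Fin L))) (n := t)
    (by simpa using htL)
  obtain ⟨U, hUA, hU⟩ := Finset.exists_subset_card_eq (s := A) (n := z) (by omega)
  refine ⟨A, hA.ge, U, hU.le, le_of_eq ?_⟩
  have hsD : S.card ≤ D := by simpa using Finset.card_le_univ S
  have e1 : ent (pairKeyPMF L D) (fun ω => (YS S ω, XT U ω))
      = ((univ ×ˢ S ∪ U ×ˢ Sᶜ : Finset (Fin L × Fin D)).card : ℝ) := by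
    apply ent_pairKey
    intro k k'
    simp only [Prod.mk.injEq, XT_key, YS_key, Prod.forall, mem_union, mem_product, mem_univ,
      true_and, mem_compl]
    grind
  have e2 : ent (pairKeyPMF L D) (XT U)
      = ((U ×ˢ univ : Finset (Fin L × Fin D)).card : ℝ) := by
    apply ent_pairKey
    intro k k'
    simp only [XT_key, Prod.forall, mem_product, mem_univ, and_true]
    grind
  have e3 : ent (pairKeyPMF L D) (fun ω => (YS S ω, ((XT A ω, YS Sᶜ ω), XT U ω)))
      = ((univ : Finset (Fin L × Fin D)).card : ℝ) := by
    apply ent_pairKey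
    intro k k'
    simp only [Prod.mk.injEq, XT_key, YS_key, Prod.forall, mem_univ, mem_compl]
    grind
  have e4 : ent (pairKeyPMF L D) (fun ω => ((XT A ω, YS Sᶜ ω), XT U ω))
      = ((univ ×ˢ Sᶜ ∪ A ×ˢ S : Finset (Fin L × Fin D)).card : ℝ) := by
    apply ent_pairKey
    intro k k'
    simp only [Prod.mk.injEq, XT_key, YS_key, Prod.forall, mem_union, mem_product, mem_univ,
      true_and, mem_compl]
    grind
  unfold condMutInf condEnt
  rw [e1, e2, e3, e4]
  rw [Finset.card_union_of_disjoint, Finset.card_union_of_disjoint]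
  · simp only [card_product, card_compl, Fintype.card_fin, card_univ, Fintype.card_prod, hA, hU]
    push_cast [Nat.cast_sub hsD]
    ring
  · rw [Finset.disjoint_left]
    simp
    grind
  · rw [Finset.disjoint_left]
    simp
    grind

end SecretSharing
end
end
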